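/- Let X ⊆ ℝ^n be closed with nonempty interior, Y ⊆ ℝ^m nonempty and open, Φ : X × Y → ℝ twice continuously differentiable on int(X) × Y and continuous relative to X × Y, and let g satisfy Assumption (G). Suppose g is prox-regular at x̄ ∈ int X for v̄ ∈ ∂g(x̄) with parameter r > 0, that ȳ ∈ Y satisfies (∂_Φ g)^{-1}(ȳ) = {x̄} and v̄ = ∇_x Φ(x̄, ȳ), that ∇²_{xx}Φ(x̄, ȳ) is negative definite with λ_max(M) < r^{-1} for M := −(∇²_{xx}Φ(x̄, ȳ))^{-1}, and that g is strictly twice epi-differentiable at x̄ for v̄. Then the generalized proximal mapping (∂_Φ g)^{-1} is strictly differentiable at ȳ with Jacobian ∇(∂_Φ g)^{-1}(ȳ) = ∇[(T_ε + M^{-1})^{-1}](∇_x Φ(x̄, ȳ) + M^{-1} x̄) · ∇²_{xy}Φ(x̄, ȳ), where T_ε is a g-attentive ε-localization of ∂g at x̄ for v̄. -/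

import Mathlib

set_option linter.unusedVariables false

open Filter Topology Metric Set Bornology
open scoped RealInnerProductSpace NNReal

noncomputable section

variable {E F : Type*} [NormedAddCommGroup E] [InnerProductSpace ℝ E] [CompleteSpace E]
  [NormedAddCommGroup F] [InnerProductSpace ℝ F] [CompleteSpace F]

/-- Gradient of the coupling `Φ` in its first argument. -/
def gradx (Φ : E → F → ℝ) (x : E) (y : F) : E :=
  gradient (fun x' => Φ x' y) x

/-- Gradient of the coupling `Φ` in its second argument. -/
def grady (Φ : E → F → ℝ) (x : E) (y : F) : F :=
  gradient (fun y' => Φ x y') y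

/-- The Φ-conjugate of `f` relative to `X`: `f^Φ(y) = sup_{x ∈ X} (Φ(x,y) − f(x))`. -/
def phiConj (X : Set E) (Φ : E → F → ℝ) (f : E → EReal) (y : F) : EReal :=
  ⨆ x ∈ X, ((Φ x y : EReal) - f x)

/-- The Φ-biconjugate of `f`: `f^{ΦΦ}(x) = sup_{y ∈ Y} (Φ(x,y) − f^Φ(y))`. -/
def phiBiconj (X : Set E) (Y : Set F) (Φ : E → F → ℝ) (f : E → EReal) (x : E) : EReal :=
  ⨆ y ∈ Y, ((Φ x y : EReal) - phiConj X Φ f y)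

/-- `f` is Φ-convex on `X`: `f` is a pointwise supremum over `X` of functions
`x ↦ Φ(x, yᵢ) − βᵢ` with `yᵢ ∈ Y` (the empty index set giving `f ≡ −∞`). -/
def PhiConvexOn (X : Set E) (Y : Set F) (Φ : E → F → ℝ) (f : E → EReal) : Prop :=
  ∃ (ι : Type) (yi : ι → F) (βi : ι → EReal),
    (∀ i, yi i ∈ Y) ∧ ∀ x ∈ X, f x = ⨆ i, ((Φ x (yi i) : EReal) - βi i)

/-- The Φ-subdifferential of `f` at `xb`:
`y ∈ ∂_Φ f(xb)` iff `y ∈ Y` and `f(x) ≥ f(xb) + Φ(x,y) − Φ(xb,y)` for all `x ∈ X`. -/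
def phiSubdiff (X : Set E) (Y : Set F) (Φ : E → F → ℝ) (f : E → EReal) (xb : E) : Set F :=
  {y | y ∈ Y ∧ ∀ x ∈ X, f xb + ((Φ x y - Φ xb y : ℝ) : EReal) ≤ f x}

/-- The Φ-subdifferential of a function `gc` on `Y` (such as `f^Φ`) at `yb`:
`x ∈ ∂_Φ gc(yb)` iff `x ∈ X` and `gc(y) ≥ gc(yb) + Φ(x,y) − Φ(x,yb)` for all `y ∈ Y`. -/
def phiSubdiffDual (X : Set E) (Y : Set F) (Φ : E → F → ℝ) (gc : F → EReal) (yb : F) : Set E :=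
  {x | x ∈ X ∧ ∀ y ∈ Y, gc yb + ((Φ x y - Φ x yb : ℝ) : EReal) ≤ gc y}

/-- The generalized proximal mapping `(∂_Φ g)^{-1}(y) = argmin_{x ∈ X} (g(x) − Φ(x,y))`. -/
def proxSet (X : Set E) (Φ : E → F → ℝ) (g : E → EReal) (y : F) : Set E :=
  {x | x ∈ X ∧ ∀ x' ∈ X, g x - ((Φ x y : ℝ) : EReal) ≤ g x' - ((Φ x' y : ℝ) : EReal)}

/-- Assumption (G): `g` is proper and lsc on `X`, `g − Φ(·,y)` is level-bounded in `x`
locally uniformly in `y`, and the range of the generalized proximal mapping lies in `int X`. -/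
structure AssumptionG (X : Set E) (Y : Set F) (Φ : E → F → ℝ) (g : E → EReal) : Prop where
  proper : ∃ x ∈ X, g x ≠ ⊤
  ne_bot : ∀ x, g x ≠ ⊥
  lsc : LowerSemicontinuousOn g X
  levelBounded : ∀ yb ∈ Y, ∀ α : ℝ, ∃ V ∈ 𝓝 yb, ∃ B : Set E, IsBounded B ∧
    ∀ y ∈ V ∩ Y, {x | x ∈ X ∧ g x - ((Φ x y : ℝ) : EReal) ≤ (α : EReal)} ⊆ B
  ran_interior : ∀ y ∈ Y, proxSet X Φ g y ⊆ interior X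

/-- `v` is a regular (Fréchet) subgradient of `f` at `x`. -/
def IsFSubgrad (f : E → EReal) (x v : E) : Prop :=
  f x ≠ ⊤ ∧ f x ≠ ⊥ ∧ ∀ ε > (0 : ℝ), ∃ δ > (0 : ℝ), ∀ x', ‖x' - x‖ < δ →
    f x + ((⟪v, x' - x⟫ - ε * ‖x' - x‖ : ℝ) : EReal) ≤ f x'

/-- `v` is a limiting (Mordukhovich) subgradient of `f` at `x`. -/
def IsLSubgrad (f : E → EReal) (x v : E) : Prop :=
  f x ≠ ⊤ ∧ f x ≠ ⊥ ∧ ∃ xs vs : ℕ → E,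
    Tendsto xs atTop (𝓝 x) ∧ Tendsto (fun ν => f (xs ν)) atTop (𝓝 (f x)) ∧
    Tendsto vs atTop (𝓝 v) ∧ ∀ ν, IsFSubgrad f (xs ν) (vs ν)

/-- `f` is locally lower semicontinuous at `xb`. -/
def LocallyLscAt (f : E → EReal) (xb : E) : Prop :=
  ∃ ε > (0 : ℝ), ∀ α : EReal, α ≤ f xb + ((ε : ℝ) : EReal) →
    IsClosed {x | x ∈ closedBall xb ε ∧ f x ≤ α}

/-- `g` is prox-regular at `xb` for `vb` with parameter `r`. -/
def ProxRegularAt (g : E → EReal) (xb vb : E) (r : ℝ) : Prop :=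
  g xb ≠ ⊤ ∧ g xb ≠ ⊥ ∧ LocallyLscAt g xb ∧ IsLSubgrad g xb vb ∧
  ∃ ε > (0 : ℝ), ∀ x x' v : E, ‖x' - xb‖ ≤ ε → ‖x - xb‖ ≤ ε →
    g x ≤ g xb + ((ε : ℝ) : EReal) → IsLSubgrad g x v → ‖v - vb‖ ≤ ε →
    g x + ((⟪v, x' - x⟫ - r / 2 * ‖x' - x‖ ^ 2 : ℝ) : EReal) ≤ g x'

/-- `g` is Φ-prox-regular at `xb` for `(vb, yb)`. -/
def PhiProxRegularAt (X : Set E) (Φ : E → F → ℝ) (g : E → EReal)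
    (xb vb : E) (yb : F) : Prop :=
  g xb ≠ ⊤ ∧ g xb ≠ ⊥ ∧ LocallyLscAt g xb ∧ IsLSubgrad g xb vb ∧
  ∃ ε > (0 : ℝ), ∀ (x x' v : E) (y : F), ‖x' - xb‖ ≤ ε → ‖x - xb‖ ≤ ε →
    g x - g xb ≤ ((ε : ℝ) : EReal) → IsLSubgrad g x v → ‖v - vb‖ ≤ ε → ‖y - yb‖ ≤ ε →
    v = gradx Φ x y →
    g x + ((Φ x' y - Φ x y : ℝ) : EReal) ≤ g x'

/-- `g` is Φ-prox-regular at `xb` for `(vb, yb)` with the subgradient inequality strict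
whenever `x' ≠ x`. -/
def PhiProxRegularStrictAt (X : Set E) (Φ : E → F → ℝ) (g : E → EReal)
    (xb vb : E) (yb : F) : Prop :=
  PhiProxRegularAt X Φ g xb vb yb ∧
  ∃ ε > (0 : ℝ), ∀ (x x' v : E) (y : F), ‖x' - xb‖ ≤ ε → ‖x - xb‖ ≤ ε →
    g x - g xb ≤ ((ε : ℝ) : EReal) → IsLSubgrad g x v → ‖v - vb‖ ≤ ε → ‖y - yb‖ ≤ ε →
    v = gradx Φ x y → x' ≠ x →
    g x + ((Φ x' y - Φ x y : ℝ) : EReal) < g x'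

/-- The `g`-attentive `ε`-localization of the limiting subdifferential `∂g` at `xb` for `vb`. -/
def gAttentiveLoc (g : E → EReal) (xb vb : E) (ε : ℝ) (x : E) : Set E :=
  {v | ‖x - xb‖ < ε ∧ g x < g xb + ((ε : ℝ) : EReal) ∧ IsLSubgrad g x v ∧ ‖v - vb‖ < ε}

/-- `Φ` is twist: for each `x ∈ int X` the map `y ↦ ∇ₓΦ(x,y)` is injective on `Y`. -/
def IsTwist (X : Set E) (Y : Set F) (Φ : E → F → ℝ) : Prop :=
  ∀ x ∈ interior X, Set.InjOn (fun y => gradx Φ x y) Y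

/-- `Φ` is a local strong twist at `(xb, yb)`: with `vb := ∇ₓΦ(xb,yb)` there is a unique
continuously differentiable map `G(x,v)` near `(xb,vb)`, with values in `Y`, such that
`G(xb,vb) = yb` and `∇ₓΦ(x, G(x,v)) = v` near `(xb,vb)`. -/
def IsLocalStrongTwist (Y : Set F) (Φ : E → F → ℝ) (xb : E) (yb : F) : Prop :=
  ∃ (G : E × E → F) (U : Set (E × E)), IsOpen U ∧ (xb, gradx Φ xb yb) ∈ U ∧
    ContDiffOn ℝ 1 G U ∧ G (xb, gradx Φ xb yb) = yb ∧ (∀ p ∈ U, G p ∈ Y) ∧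
    (∀ p ∈ U, gradx Φ p.1 (G p) = p.2) ∧
    ∀ (G' : E × E → F) (U' : Set (E × E)), IsOpen U' → (xb, gradx Φ xb yb) ∈ U' →
      ContDiffOn ℝ 1 G' U' → G' (xb, gradx Φ xb yb) = yb → (∀ p ∈ U', G' p ∈ Y) →
      (∀ p ∈ U', gradx Φ p.1 (G' p) = p.2) →
      ∀ᶠ p in 𝓝 (xb, gradx Φ xb yb), G' p = G p

/-- `Φ` is a global strong twist. -/
def IsGlobalStrongTwist (X : Set E) (Y : Set F) (Φ : E → F → ℝ) : Prop :=
  IsTwist X Y Φ ∧ ∀ xb ∈ interior X, ∀ yb ∈ Y, IsLocalStrongTwist Y Φ xb yb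

/-- `σ` is a single-valued localization of the set-valued map `Fm` around `pb` for `qb`,
with domain of localization `U`. -/
def IsSVLocalization {α β : Type*} [TopologicalSpace α] [TopologicalSpace β]
    (Fm : α → Set β) (pb : α) (qb : β) (σ : α → β) (U : Set α) : Prop :=
  U ∈ 𝓝 pb ∧ σ pb = qb ∧ ∃ V ∈ 𝓝 qb, ∀ p ∈ U, Fm p ∩ V = {σ p}

/-- `H` is a first-order approximation to `Fm` at `xb`. -/
def IsFOApprox {α β : Type*} [NormedAddCommGroup α] [NormedAddCommGroup β]
    (Fm H : α → β) (xb : α) : Prop :=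
  H xb = Fm xb ∧ ∀ ε > (0 : ℝ), ∃ V ∈ 𝓝 xb, ∀ x ∈ V, ‖Fm x - H x‖ ≤ ε * ‖x - xb‖

/-- `H` is a strict first-order approximation to `Fm` at `xb`. -/
def IsStrictFOApprox {α β : Type*} [NormedAddCommGroup α] [NormedAddCommGroup β]
    (Fm H : α → β) (xb : α) : Prop :=
  H xb = Fm xb ∧ ∀ ε > (0 : ℝ), ∃ V ∈ 𝓝 xb, ∀ x ∈ V, ∀ x' ∈ V,
    ‖Fm x - H x - (Fm x' - H x')‖ ≤ ε * ‖x - x'‖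

/-- Sequential epi-convergence of `fs` to `f`. -/
def EpiConvergesSeq (fs : ℕ → E → EReal) (f : E → EReal) : Prop :=
  ∀ w : E,
    (∀ ws : ℕ → E, Tendsto ws atTop (𝓝 w) →
      f w ≤ Filter.liminf (fun ν => fs ν (ws ν)) atTop) ∧
    (∃ ws : ℕ → E, Tendsto ws atTop (𝓝 w) ∧
      Filter.limsup (fun ν => fs ν (ws ν)) atTop ≤ f w)

/-- `g` is strictly twice epi-differentiable at `xb` for `vb`: the second-order difference
quotients epi-converge to a common limit along every sequence `tₙ ↘ 0`,
`(xₙ, vₙ) → (xb, vb)` with `vₙ ∈ ∂g(xₙ)` and `g(xₙ) → g(xb)`. -/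
def StrictTwiceEpiDiff (g : E → EReal) (xb vb : E) : Prop :=
  ∃ h : E → EReal, ∀ (ts : ℕ → ℝ) (xs vs : ℕ → E),
    (∀ ν, 0 < ts ν) → Tendsto ts atTop (𝓝 0) →
    Tendsto xs atTop (𝓝 xb) → Tendsto vs atTop (𝓝 vb) →
    (∀ ν, IsLSubgrad g (xs ν) (vs ν)) →
    Tendsto (fun ν => g (xs ν)) atTop (𝓝 (g xb)) →
    EpiConvergesSeq (fun ν w =>
      ((2 / (ts ν) ^ 2 : ℝ) : EReal) *
        (g (xs ν + ts ν • w) - g (xs ν) - ((ts ν * ⟪vs ν, w⟫ : ℝ) : EReal))) h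

/-- `g` is prox-bounded with threshold `lamg`. -/
def ProxBoundedWith (g : E → EReal) (lamg : ℝ) : Prop :=
  ∀ lam : ℝ, 0 < lam → lam < lamg → ∃ (y : E) (b : ℝ), ∀ x : E,
    (b : EReal) ≤ g x + ((1 / (2 * lam) * ‖x - y‖ ^ 2 : ℝ) : EReal)

/-- `φ` is lower-C¹ on the open set `O`: locally a max over a compact index set `Z`
of functions `h(x, ·)` that are continuous in `(x,y)` together with their `y`-gradients. -/
def LowerC1On (φ : F → ℝ) (O : Set F) : Prop :=
  ∀ y₀ ∈ O, ∃ (V : Set F) (Z : Set E) (h : E → F → ℝ) (hy : E → F → F),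
    V ∈ 𝓝 y₀ ∧ IsCompact Z ∧ Z.Nonempty ∧
    ContinuousOn (fun p : E × F => h p.1 p.2) (Z ×ˢ V) ∧
    ContinuousOn (fun p : E × F => hy p.1 p.2) (Z ×ˢ V) ∧
    (∀ x ∈ Z, ∀ y ∈ V, HasGradientAt (h x) (hy x y) y) ∧
    ∀ y ∈ V, (∃ x ∈ Z, φ y = h x y) ∧ ∀ x ∈ Z, h x y ≤ φ y

section LocalizedSubdifferential

variable {E : Type*} [NormedAddCommGroup E] [InnerProductSpace ℝ E]

/-- The prox-regularity inequality, stated for the `g`-attentive localization `T_ε` of `∂g`. -/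
def ProxIneq (g : E → EReal) (xb vb : E) (r ε : ℝ) : Prop :=
  ∀ x v, v ∈ gAttentiveLoc g xb vb ε x → ∀ x', ‖x' - xb‖ < ε →
    g x + ((⟪v, x' - x⟫ - r / 2 * ‖x' - x‖ ^ 2 : ℝ) : EReal) ≤ g x'

lemma ProxRegularAt.exists_proxIneq {g : E → EReal} {xb vb : E} {r : ℝ}
    (h : ProxRegularAt g xb vb r) : ∃ ε > (0 : ℝ), ProxIneq g xb vb r ε := by
  obtain ⟨-, -, -, -, ε, hε, H⟩ := h
  exact ⟨ε, hε, fun x v hv x' hx' => H x x' v hx'.le hv.1.le hv.2.1.le hv.2.2.1 hv.2.2.2.le⟩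

lemma IsLSubgrad.exists_coe {g : E → EReal} {x v : E} (h : IsLSubgrad g x v) :
    ∃ a : ℝ, g x = a :=
  ⟨(g x).toReal, (EReal.coe_toReal h.1 h.2.1).symm⟩

lemma mem_gAttentiveLoc_self {g : E → EReal} {xb vb : E} {ε : ℝ} (hε : 0 < ε)
    (h : IsLSubgrad g xb vb) : vb ∈ gAttentiveLoc g xb vb ε xb := by
  refine ⟨by simpa using hε, ?_, h, by simpa using hε⟩
  obtain ⟨a, ha⟩ := h.exists_coe
  rw [ha]
  exact_mod_cast lt_add_of_pos_right a hε

/-- Strong monotonicity of `T_ε - A`. -/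
lemma ProxIneq.strongMono {g : E → EReal} {xb vb : E} {r ε s : ℝ} (H : ProxIneq g xb vb r ε)
    {A : E →L[ℝ] E} (hs : ∀ u, ⟪A u, u⟫ ≤ -(s * ‖u‖ ^ 2)) {x₁ v₁ x₂ v₂ : E}
    (h₁ : v₁ ∈ gAttentiveLoc g xb vb ε x₁) (h₂ : v₂ ∈ gAttentiveLoc g xb vb ε x₂) :
    (s - r) * ‖x₁ - x₂‖ ^ 2 ≤ ⟪(v₁ - A x₁) - (v₂ - A x₂), x₁ - x₂⟫ := by
  have e₁ := H x₁ v₁ h₁ x₂ h₂.1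
  have e₂ := H x₂ v₂ h₂ x₁ h₁.1
  obtain ⟨a, ha⟩ := h₁.2.2.1.exists_coe
  obtain ⟨b, hb⟩ := h₂.2.2.1.exists_coe
  rw [ha, hb] at e₁ e₂
  norm_cast at e₁ e₂
  have h := hs (x₁ - x₂)
  have hn : ‖x₂ - x₁‖ = ‖x₁ - x₂‖ := norm_sub_rev _ _
  rw [← neg_sub x₁ x₂, inner_neg_right, norm_neg] at e₁
  have : ⟪(v₁ - A x₁) - (v₂ - A x₂), x₁ - x₂⟫
      = ⟪v₁, x₁ - x₂⟫ - ⟪v₂, x₁ - x₂⟫ - ⟪A (x₁ - x₂), x₁ - x₂⟫ := by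
    simp only [map_sub, inner_sub_left]; ring
  rw [this]
  linarith

lemma ProxIneq.norm_sub_le {g : E → EReal} {xb vb : E} {r ε s : ℝ} (H : ProxIneq g xb vb r ε)
    {A : E →L[ℝ] E} (hs : ∀ u, ⟪A u, u⟫ ≤ -(s * ‖u‖ ^ 2)) {x₁ v₁ x₂ v₂ : E}
    (h₁ : v₁ ∈ gAttentiveLoc g xb vb ε x₁) (h₂ : v₂ ∈ gAttentiveLoc g xb vb ε x₂) :
    (s - r) * ‖x₁ - x₂‖ ≤ ‖(v₁ - A x₁) - (v₂ - A x₂)‖ := by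
  rcases eq_or_ne x₁ x₂ with rfl | hne
  · simp
  have hp : 0 < ‖x₁ - x₂‖ := norm_pos_iff.2 (sub_ne_zero.2 hne)
  refine le_of_mul_le_mul_right ?_ hp
  calc _ = (s - r) * ‖x₁ - x₂‖ ^ 2 := by ring
    _ ≤ _ := H.strongMono hs h₁ h₂
    _ ≤ _ := real_inner_le_norm _ _

/-- `g` is continuous along the graph of `T_ε` at `(xb, vb)`. -/
lemma ProxIneq.tendsto_apply {ι : Type*} {l : Filter ι} {g : E → EReal} {xb vb : E} {r ε : ℝ}
    (H : ProxIneq g xb vb r ε) (hb : vb ∈ gAttentiveLoc g xb vb ε xb) {xs vs : ι → E}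
    (hx : Tendsto xs l (𝓝 xb)) (hv : Tendsto vs l (𝓝 vb))
    (h : ∀ i, vs i ∈ gAttentiveLoc g xb vb ε (xs i)) :
    Tendsto (fun i => g (xs i)) l (𝓝 (g xb)) := by
  obtain ⟨b, hgb⟩ := hb.2.2.1.exists_coe
  have hx0 : Tendsto (fun i => xs i - xb) l (𝓝 0) := by simpa using hx.sub_const xb
  have hx1 : Tendsto (fun i => xb - xs i) l (𝓝 0) := by simpa using hx.const_sub xb
  have l₁ : Tendsto (fun i => b + (⟪vb, xs i - xb⟫ - r / 2 * ‖xs i - xb‖ ^ 2)) l (𝓝 b) := by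
    simpa using (((tendsto_const_nhds (x := vb)).inner hx0).sub
      ((hx0.norm.pow 2).const_mul (r / 2))).const_add b
  have l₂ : Tendsto (fun i => b - (⟪vs i, xb - xs i⟫ - r / 2 * ‖xb - xs i‖ ^ 2)) l (𝓝 b) := by
    simpa using ((hv.inner hx1).sub ((hx1.norm.pow 2).const_mul (r / 2))).const_sub b
  rw [hgb]
  refine tendsto_of_tendsto_of_tendsto_of_le_of_le
    ((continuous_coe_real_ereal.tendsto b).comp l₁)
    ((continuous_coe_real_ereal.tendsto b).comp l₂) (fun i => ?_) (fun i => ?_)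
  · have := H xb vb hb (xs i) (h i).1
    rw [hgb] at this
    simpa using this
  · have := H (xs i) (vs i) (h i) xb hb.1
    obtain ⟨a, ha⟩ := (h i).2.2.1.exists_coe
    rw [hgb, ha] at this
    simp only [Function.comp_apply, ha]
    norm_cast at this ⊢
    linarith

/-- The second-order difference quotient of `g` at `x` for `v`. -/
def secondQuot (g : E → EReal) (x v : E) (t : ℝ) (w : E) : EReal :=
  ((2 / t ^ 2 : ℝ) : EReal) * (g (x + t • w) - g x - ((t * ⟪v, w⟫ : ℝ) : EReal))

lemma ProxIneq.secondQuot_le {g : E → EReal} {xb vb : E} {r ε : ℝ} (H : ProxIneq g xb vb r ε)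
    {x v v₁ w w' : E} {t : ℝ} (ht : 0 < t) (h : v ∈ gAttentiveLoc g xb vb ε x)
    (h₁ : v₁ ∈ gAttentiveLoc g xb vb ε (x + t • w)) (hw' : ‖x + t • w' - xb‖ < ε) :
    secondQuot g x v t w
      + ((2 * ⟪t⁻¹ • (v₁ - v), w' - w⟫ - r * ‖w' - w‖ ^ 2 : ℝ) : EReal)
      ≤ secondQuot g x v t w' := by
  have e := H _ _ h₁ _ hw'
  obtain ⟨a, ha⟩ := h.2.2.1.exists_coe
  obtain ⟨b, hb⟩ := h₁.2.2.1.exists_coe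
  have hsub : x + t • w' - (x + t • w) = t • (w' - w) := by module
  have ht2 : 0 < 2 / t ^ 2 := by positivity
  rw [hb, hsub] at e
  unfold secondQuot
  rw [ha, hb]
  induction hc : g (x + t • w') using EReal.rec with
  | bot =>
    rw [hc, ← EReal.coe_add] at e
    exact absurd (le_bot_iff.1 e) (EReal.coe_ne_bot _)
  | top =>
    rw [EReal.top_sub_coe, EReal.top_sub_coe, EReal.coe_mul_top_of_pos ht2]
    exact le_top
  | coe c =>
    rw [hc] at e
    norm_cast at e ⊢
    rw [inner_smul_right, norm_smul, Real.norm_of_nonneg ht.le] at e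
    rw [real_inner_smul_left, inner_sub_left]
    have e2 : ⟪v, w' - w⟫ = ⟪v, w'⟫ - ⟪v, w⟫ := inner_sub_right _ _ _
    have : (2 / t ^ 2) * (b + (t * ⟪v₁, w' - w⟫ - r / 2 * (t * ‖w' - w‖) ^ 2)) ≤ 2 / t ^ 2 * c :=
      by gcongr
    rw [e2]
    have k1 : 2 / t ^ 2 * (b + (t * ⟪v₁, w' - w⟫ - r / 2 * (t * ‖w' - w‖) ^ 2))
      = 2 / t ^ 2 * b + 2 * t⁻¹ * ⟪v₁, w' - w⟫ - r * ‖w' - w‖ ^ 2 := by field_simp; ring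
    have k2 : ∀ z, 2 / t ^ 2 * (t * z) = 2 * t⁻¹ * z := fun z => by field_simp
    rw [k1] at this
    simp only [mul_sub, k2]
    linarith

lemma secondQuot_zero {g : E → EReal} {x v : E} (h : IsLSubgrad g x v) (t : ℝ) :
    secondQuot g x v t 0 = 0 := by
  obtain ⟨a, ha⟩ := h.exists_coe
  simp [secondQuot, ha]

/-- The stationarity property satisfied by the limits `w` of the difference quotients of
`(T_ε - A)⁻¹` in the direction `d`, in terms of the epi-limit `h` of the second-order quotients
of `g`. -/
def IsQuotLimit (h : E → EReal) (A : E →L[ℝ] E) (r : ℝ) (d w : E) : Prop :=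
  h w ≠ ⊤ ∧ h w ≠ ⊥ ∧ ∀ w', h w
    + ((2 * ⟪d + A w, w' - w⟫ - r * ‖w' - w‖ ^ 2 : ℝ) : EReal) ≤ h w'

lemma IsQuotLimit.unique {h : E → EReal} {A : E →L[ℝ] E} {r s : ℝ} (hrs : r < s)
    (hs : ∀ u, ⟪A u, u⟫ ≤ -(s * ‖u‖ ^ 2)) {d w₁ w₂ : E} (h₁ : IsQuotLimit h A r d w₁)
    (h₂ : IsQuotLimit h A r d w₂) : w₁ = w₂ := by
  have e₁ := h₁.2.2 w₂
  have e₂ := h₂.2.2 w₁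
  rw [← EReal.coe_toReal h₁.1 h₁.2.1, ← EReal.coe_toReal h₂.1 h₂.2.1] at e₁ e₂
  norm_cast at e₁ e₂
  have hA := hs (w₁ - w₂)
  rw [← neg_sub w₁ w₂, inner_neg_right, norm_neg] at e₁
  simp only [map_sub, inner_sub_left, inner_add_left] at hA e₁ e₂
  by_contra hne
  have hp : 0 < ‖w₁ - w₂‖ := norm_pos_iff.2 (sub_ne_zero.2 hne)
  nlinarith [mul_pos (sub_pos.2 hrs) (pow_pos hp 2)]

/-- Passing to the epi-limit in an eventual inequality. -/
lemma EpiConvergesSeq.le_of_eventually_add_le {E : Type*} [NormedAddCommGroup E]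
    {fs : ℕ → E → EReal} {h : E → EReal}
    (hf : EpiConvergesSeq fs h) {w w' : E} {ws ws' : ℕ → E} (hws : Tendsto ws atTop (𝓝 w))
    (hws' : limsup (fun k => fs k (ws' k)) atTop ≤ h w')
    {cs : ℕ → ℝ} {c : ℝ} (hc : Tendsto cs atTop (𝓝 c))
    (hle : ∀ᶠ k in atTop, fs k (ws k) + (cs k : EReal) ≤ fs k (ws' k)) :
    h w + (c : EReal) ≤ h w' := by
  have hc' : liminf (fun k => (cs k : EReal)) atTop = c :=
    ((continuous_coe_real_ereal.tendsto c).comp hc).liminf_eq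
  calc h w + (c : EReal)
      ≤ liminf (fun k => fs k (ws k)) atTop + liminf (fun k => (cs k : EReal)) atTop := by
        rw [hc']; gcongr; exact (hf w).1 ws hws
    _ ≤ liminf (fun k => fs k (ws k) + (cs k : EReal)) atTop := EReal.le_liminf_add
    _ ≤ liminf (fun k => fs k (ws' k)) atTop := liminf_le_liminf hle
    _ ≤ limsup (fun k => fs k (ws' k)) atTop := liminf_le_limsup
    _ ≤ h w' := hws'

lemma ProxIneq.isQuotLimit {g : E → EReal} {xb vb : E} {r ε : ℝ} (H : ProxIneq g xb vb r ε)
    (hε : 0 < ε) {h : E → EReal} {A : E →L[ℝ] E} {ts : ℕ → ℝ} {xs vs ds ws : ℕ → E} {d w : E}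
    (ht : ∀ k, 0 < ts k) (ht0 : Tendsto ts atTop (𝓝 0)) (hx : Tendsto xs atTop (𝓝 xb))
    (hd : Tendsto ds atTop (𝓝 d)) (hw : Tendsto ws atTop (𝓝 w))
    (hv : ∀ k, vs k ∈ gAttentiveLoc g xb vb ε (xs k))
    (hv' : ∀ k, vs k + ts k • (ds k + A (ws k)) ∈ gAttentiveLoc g xb vb ε (xs k + ts k • ws k))
    (hf : EpiConvergesSeq (fun k => secondQuot g (xs k) (vs k) (ts k)) h) :
    IsQuotLimit h A r d w := by
  have near : ∀ {w' : E} {ws' : ℕ → E}, Tendsto ws' atTop (𝓝 w') →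
      ∀ᶠ k in atTop, ‖xs k + ts k • ws' k - xb‖ < ε := by
    intro w' ws' hw'
    have : Tendsto (fun k => ‖xs k + ts k • ws' k - xb‖) atTop (𝓝 0) := by
      simpa using ((hx.add (ht0.smul hw')).sub_const xb).norm
    exact this.eventually_lt_const hε
  have main : ∀ {w' : E} {ws' : ℕ → E}, Tendsto ws' atTop (𝓝 w') →
      ∀ᶠ k in atTop, secondQuot g (xs k) (vs k) (ts k) (ws k)
        + ((2 * ⟪ds k + A (ws k), ws' k - ws k⟫ - r * ‖ws' k - ws k‖ ^ 2 : ℝ) : EReal)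
        ≤ secondQuot g (xs k) (vs k) (ts k) (ws' k) := by
    intro w' ws' hw'
    filter_upwards [near hw'] with k hk
    have := H.secondQuot_le (ht k) (hv k) (hv' k) hk
    rwa [add_sub_cancel_left, inv_smul_smul₀ (ht k).ne'] at this
  have lim : ∀ {w' : E} {ws' : ℕ → E}, Tendsto ws' atTop (𝓝 w') →
      Tendsto (fun k => 2 * ⟪ds k + A (ws k), ws' k - ws k⟫ - r * ‖ws' k - ws k‖ ^ 2) atTop
        (𝓝 (2 * ⟪d + A w, w' - w⟫ - r * ‖w' - w‖ ^ 2)) := by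
    intro w' ws' hw'
    have hA : Tendsto (fun k => A (ws k)) atTop (𝓝 (A w)) := (A.continuous.tendsto w).comp hw
    exact (((hd.add hA).inner (hw'.sub hw)).const_mul 2).sub
      ((((hw'.sub hw).norm).pow 2).const_mul r)
  refine ⟨?_, ?_, fun w' => ?_⟩
  · have h0 := main (tendsto_const_nhds (x := (0 : E)))
    have hc := lim (tendsto_const_nhds (x := (0 : E)))
    set cs : ℕ → ℝ := fun k =>
      2 * ⟪ds k + A (ws k), 0 - ws k⟫ - r * ‖0 - ws k‖ ^ 2 with hcs
    set c := 2 * ⟪d + A w, 0 - w⟫ - r * ‖0 - w‖ ^ 2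
    have hle : ∀ᶠ k in atTop, secondQuot g (xs k) (vs k) (ts k) (ws k) ≤ ((1 - c : ℝ) : EReal) := by
      filter_upwards [h0, hc.eventually_const_lt (sub_one_lt c)] with k hk hk'
      rw [secondQuot_zero (hv k).2.2.1] at hk
      have h1 : secondQuot g (xs k) (vs k) (ts k) (ws k) ≤ ((-cs k : ℝ) : EReal) := by
        have := EReal.le_sub_iff_add_le (a := secondQuot g (xs k) (vs k) (ts k) (ws k))
          (b := (cs k : EReal)) (c := 0) (.inl (EReal.coe_ne_bot _)) (.inl (EReal.coe_ne_top _))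
        simpa using this.2 hk
      refine h1.trans ?_
      norm_cast
      linarith
    have : h w ≤ ((1 - c : ℝ) : EReal) := by
      refine ((hf w).1 ws hw).trans ?_
      calc _ ≤ liminf (fun _ : ℕ => ((1 - c : ℝ) : EReal)) atTop := liminf_le_liminf hle
        _ = _ := liminf_const _
    exact (this.trans_lt (EReal.coe_lt_top _)).ne
  · obtain ⟨ws', hw', hl⟩ := (hf w).2
    have hle : ∀ᶠ k in atTop, ((-(r * ‖w‖ ^ 2) - 1 : ℝ) : EReal)
        ≤ secondQuot g (xs k) (vs k) (ts k) (ws' k) := by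
      have hlim : Tendsto (fun k => -(r * ‖ws' k‖ ^ 2)) atTop (𝓝 (-(r * ‖w‖ ^ 2))) :=
        ((hw'.norm.pow 2).const_mul r).neg
      filter_upwards [near hw', hlim.eventually_const_lt (sub_one_lt _)] with k hk hk'
      have := H.secondQuot_le (w := 0) (ht k) (hv k) (by simpa using hv k) hk
      rw [secondQuot_zero (hv k).2.2.1, zero_add] at this
      refine le_trans ?_ this
      norm_cast
      simpa using hk'.le
    have : ((-(r * ‖w‖ ^ 2) - 1 : ℝ) : EReal) ≤ h w := by
      calc _ = liminf (fun _ : ℕ => ((-(r * ‖w‖ ^ 2) - 1 : ℝ) : EReal)) atTop :=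
            (liminf_const _).symm
        _ ≤ _ := liminf_le_liminf hle
        _ ≤ _ := liminf_le_limsup
        _ ≤ _ := hl
    exact ((EReal.bot_lt_coe _).trans_le this).ne'
  · obtain ⟨ws', hw', hl⟩ := (hf w').2
    exact hf.le_of_eventually_add_le hw hl (lim hw') (main hw')

/-- The difference quotient `(σ(u + t d) - σ(u)) / t` of `σ` at the triple `(u, t, d)`. -/
def diffQuot (σ : E → E) (z : E × ℝ × E) : E :=
  z.2.1⁻¹ • (σ (z.1 + z.2.1 • z.2.2) - σ z.1)

lemma tendsto_add_smul (ub d : E) :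
    Tendsto (fun z : E × ℝ × E => z.1 + z.2.1 • z.2.2) (𝓝 ub ×ˢ 𝓝[>] (0 : ℝ) ×ˢ 𝓝 d)
      (𝓝 ub) := by
  have h1 : Tendsto (fun z : E × ℝ × E => z.1) (𝓝 ub ×ˢ 𝓝[>] (0 : ℝ) ×ˢ 𝓝 d) (𝓝 ub) :=
    tendsto_fst
  have h2 : Tendsto (fun z : E × ℝ × E => z.2.1) (𝓝 ub ×ˢ 𝓝[>] (0 : ℝ) ×ˢ 𝓝 d) (𝓝 0) :=
    (tendsto_fst.comp tendsto_snd).mono_right nhdsWithin_le_nhds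
  have h3 : Tendsto (fun z : E × ℝ × E => z.2.2) (𝓝 ub ×ˢ 𝓝[>] (0 : ℝ) ×ˢ 𝓝 d) (𝓝 d) :=
    tendsto_snd.comp tendsto_snd
  simpa using h1.add (h2.smul h3)

/-- If the directional difference quotients of `σ` converge strictly in every direction, and `σ`
is Lipschitz near `ub`, then `σ` is strictly differentiable at `ub`. -/
lemma exists_hasStrictFDerivAt_of_tendsto_diffQuot [FiniteDimensional ℝ E] {σ : E → E} {ub : E}
    {K : ℝ} {U : Set E} (hU : U ∈ 𝓝 ub)
    (hlip : ∀ u ∈ U, ∀ u' ∈ U, ‖σ u - σ u'‖ ≤ K * ‖u - u'‖)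
    {W : E → E}
    (hW : ∀ d, Tendsto (diffQuot σ) (𝓝 ub ×ˢ 𝓝[>] (0 : ℝ) ×ˢ 𝓝 d) (𝓝 (W d))) :
    ∃ D : E →L[ℝ] E, HasStrictFDerivAt σ D ub := by
  have hsec : ∀ d : E, Tendsto (fun z : E × ℝ => (z.1, z.2, d)) (𝓝 ub ×ˢ 𝓝[>] (0 : ℝ))
      (𝓝 ub ×ˢ 𝓝[>] (0 : ℝ) ×ˢ 𝓝 d) := fun d =>
    tendsto_fst.prodMk (tendsto_snd.prodMk tendsto_const_nhds)
  have hW' := fun d => (hW d).comp (hsec d)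
  have hadd : ∀ d d', W (d + d') = W d + W d' := by
    intro d d'
    have hshift : Tendsto (fun z : E × ℝ => (z.1 + z.2 • d, z.2, d')) (𝓝 ub ×ˢ 𝓝[>] (0 : ℝ))
        (𝓝 ub ×ˢ 𝓝[>] (0 : ℝ) ×ˢ 𝓝 d') :=
      ((tendsto_add_smul ub d).comp (hsec d)).prodMk (tendsto_snd.prodMk tendsto_const_nhds)
    refine tendsto_nhds_unique (hW' (d + d')) (((hW' d).add ((hW d').comp hshift)).congr ?_)
    intro z
    simp only [diffQuot, Function.comp_apply, smul_add, ← add_assoc]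
    rw [← smul_add]
    congr 1
    abel
  have hWlip : ∀ d d', ‖W d - W d'‖ ≤ K * ‖d - d'‖ := by
    intro d d'
    refine le_of_tendsto ((hW' d).sub (hW' d')).norm ?_
    filter_upwards [((tendsto_add_smul ub d).comp (hsec d)).eventually_mem hU,
      ((tendsto_add_smul ub d').comp (hsec d')).eventually_mem hU,
      tendsto_snd.eventually_mem (self_mem_nhdsWithin : Ioi (0 : ℝ) ∈ 𝓝[>] 0)]
      with z h1 h2 h3
    have h3 : 0 < z.2 := h3
    simp only [diffQuot, Function.comp_apply] at h1 h2 ⊢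
    rw [← smul_sub, sub_sub_sub_cancel_right, norm_smul, norm_inv, Real.norm_of_nonneg h3.le,
      inv_mul_le_iff₀ h3]
    refine (hlip _ h1 _ h2).trans (le_of_eq ?_)
    rw [add_sub_add_left_eq_sub, ← smul_sub, norm_smul, Real.norm_of_nonneg h3.le]
    ring
  have hcont : Continuous W := by
    refine continuous_iff_continuousAt.2 fun d => ?_
    refine tendsto_iff_norm_sub_tendsto_zero.2 ?_
    refine squeeze_zero (fun _ => norm_nonneg _) (fun d' => hWlip d' d) ?_
    have : Tendsto (fun d' => d' - d) (𝓝 d) (𝓝 0) := by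
      simpa using (tendsto_id (x := 𝓝 d)).sub_const d
    simpa using this.norm.const_mul K
  let D : E →L[ℝ] E := (AddMonoidHom.mk' W hadd).toRealLinearMap hcont
  have hD : ∀ d, D d = W d := fun _ => rfl
  refine ⟨D, .of_isLittleO (Asymptotics.isLittleO_iff.2 fun c hc => ?_)⟩
  have hev : {z : E × E × ℝ | ‖diffQuot σ (z.2.1, z.2.2, z.1) - D z.1‖ < c}
      ∈ 𝓝ˢ (sphere (0 : E) 1) ×ˢ (𝓝 ub ×ˢ 𝓝[>] (0 : ℝ)) := by
    refine (isCompact_sphere (0 : E) 1).mem_nhdsSet_prod_of_forall fun d _ => ?_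
    have h1 : Tendsto (fun z : E × E × ℝ => (z.2.1, z.2.2, z.1))
        (𝓝 d ×ˢ (𝓝 ub ×ˢ 𝓝[>] (0 : ℝ))) (𝓝 ub ×ˢ 𝓝[>] (0 : ℝ) ×ˢ 𝓝 d) :=
      (tendsto_fst.comp tendsto_snd).prodMk ((tendsto_snd.comp tendsto_snd).prodMk tendsto_fst)
    have h2 : Tendsto (fun z : E × E × ℝ => D z.1)
        (𝓝 d ×ˢ (𝓝 ub ×ˢ 𝓝[>] (0 : ℝ))) (𝓝 (W d)) :=
      (D.continuous.tendsto d).comp tendsto_fst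
    have h3 := (((hW d).comp h1).sub h2).norm
    rw [sub_self, norm_zero] at h3
    exact h3.eventually_lt_const hc
  obtain ⟨S, hS, T, hT, hST⟩ := mem_prod_iff.1 hev
  have hdiag : Tendsto (fun z : E × E => (z.2, ‖z.1 - z.2‖))
      (𝓝 (ub, ub) ⊓ 𝓟 {z | z.1 ≠ z.2}) (𝓝 ub ×ˢ 𝓝[>] (0 : ℝ)) := by
    refine Tendsto.prodMk ((continuous_snd.tendsto (ub, ub)).mono_left inf_le_left)
      (tendsto_nhdsWithin_iff.2 ⟨?_, ?_⟩)
    · refine Tendsto.mono_left ?_ inf_le_left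
      simpa using ((continuous_fst.sub continuous_snd).norm.tendsto (ub, ub) :
        Tendsto (fun z : E × E => ‖z.1 - z.2‖) _ _)
    · exact mem_inf_of_right fun z hz => norm_pos_iff.2 (sub_ne_zero.2 hz)
  filter_upwards [eventually_inf_principal.1 (hdiag.eventually_mem hT)] with z hz
  rcases eq_or_ne z.1 z.2 with he | hne
  · simp [he]
  have hp : 0 < ‖z.1 - z.2‖ := norm_pos_iff.2 (sub_ne_zero.2 hne)
  have hsph : ‖z.1 - z.2‖⁻¹ • (z.1 - z.2) ∈ S :=
    subset_of_mem_nhdsSet hS (by simp [norm_smul, hp.ne'])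
  have := (show ‖_‖ < c from hST (mk_mem_prod hsph (hz hne))).le
  simp only [diffQuot, smul_inv_smul₀ hp.ne', add_sub_cancel, map_smul, ← smul_sub,
    norm_smul, norm_inv, norm_norm] at this
  rw [inv_mul_le_iff₀ hp] at this
  linarith

lemma ProxIneq.exists_hasStrictFDerivAt [FiniteDimensional ℝ E] {g : E → EReal} {xb vb : E}
    {r ε s : ℝ} (H : ProxIneq g xb vb r ε) (hε : 0 < ε) {A : E →L[ℝ] E} (hrs : r < s)
    (hs : ∀ u, ⟪A u, u⟫ ≤ -(s * ‖u‖ ^ 2)) (hepi : StrictTwiceEpiDiff g xb vb)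
    (hb : vb ∈ gAttentiveLoc g xb vb ε xb) {σ : E → E} (hσ0 : σ (vb - A xb) = xb)
    (hσ : ∀ᶠ u in 𝓝 (vb - A xb), u + A (σ u) ∈ gAttentiveLoc g xb vb ε (σ u)) :
    ∃ D : E →L[ℝ] E, HasStrictFDerivAt σ D (vb - A xb) := by
  obtain ⟨h, hepi⟩ := hepi
  have hsr : 0 < s - r := sub_pos.2 hrs
  set ub := vb - A xb with hub
  set U := {u | u + A (σ u) ∈ gAttentiveLoc g xb vb ε (σ u)} with hU
  have hlip : ∀ u ∈ U, ∀ u' ∈ U, ‖σ u - σ u'‖ ≤ (s - r)⁻¹ * ‖u - u'‖ := by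
    intro u hu u' hu'
    rw [le_inv_mul_iff₀ hsr]
    simpa using H.norm_sub_le hs hu hu'
  have hubU : ub ∈ U := by
    change ub + A (σ ub) ∈ gAttentiveLoc g xb vb ε (σ ub)
    rwa [hσ0, hub, sub_add_cancel]
  have hcont : Tendsto σ (𝓝 ub) (𝓝 xb) := by
    refine tendsto_iff_norm_sub_tendsto_zero.2 ?_
    refine squeeze_zero' (.of_forall fun _ => norm_nonneg _)
      (g := fun u => (s - r)⁻¹ * ‖u - ub‖) ?_ ?_
    · filter_upwards [hσ] with u hu
      simpa [hσ0] using hlip u hu ub hubU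
    · have : Tendsto (fun u => u - ub) (𝓝 ub) (𝓝 0) := by
        simpa using (tendsto_id (x := 𝓝 ub)).sub_const ub
      simpa using this.norm.const_mul (s - r)⁻¹
  have cluster : ∀ d, ∀ z : ℕ → E × ℝ × E,
      Tendsto z atTop (𝓝 ub ×ˢ 𝓝[>] (0 : ℝ) ×ˢ 𝓝 d) →
      ∃ (φ : ℕ → ℕ) (w : E), IsQuotLimit h A r d w ∧
        Tendsto (fun k => diffQuot σ (z (φ k))) atTop (𝓝 w) := by
    intro d z hz
    have hz1 : Tendsto (fun k => (z k).1) atTop (𝓝 ub) := tendsto_fst.comp hz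
    have hz2 : Tendsto (fun k => (z k).2.1) atTop (𝓝[>] 0) :=
      (tendsto_fst.comp tendsto_snd).comp hz
    have hz3 : Tendsto (fun k => (z k).2.2) atTop (𝓝 d) :=
      (tendsto_snd.comp tendsto_snd).comp hz
    have good : ∀ᶠ k in atTop, (z k).1 ∈ U ∧ (z k).1 + (z k).2.1 • (z k).2.2 ∈ U ∧
        0 < (z k).2.1 ∧ ‖(z k).2.2‖ < ‖d‖ + 1 :=
      (hz1.eventually_mem hσ).and ((((tendsto_add_smul ub d).comp hz).eventually_mem hσ).and
        ((hz2.eventually_mem self_mem_nhdsWithin).and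
          (hz3.norm.eventually_lt_const (lt_add_one _))))
    obtain ⟨N, hN⟩ := eventually_atTop.1 good
    have hbd : ∀ k, diffQuot σ (z (k + N)) ∈ closedBall (0 : E) ((s - r)⁻¹ * (‖d‖ + 1)) := by
      intro k
      obtain ⟨h1, h2, h3, h4⟩ := hN (k + N) (Nat.le_add_left _ _)
      rw [mem_closedBall_zero_iff, diffQuot, norm_smul, norm_inv, Real.norm_of_nonneg h3.le,
        inv_mul_le_iff₀ h3]
      refine (hlip _ h2 _ h1).trans ?_
      rw [add_sub_cancel_left, norm_smul, Real.norm_of_nonneg h3.le]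
      calc (s - r)⁻¹ * ((z (k + N)).2.1 * ‖(z (k + N)).2.2‖)
          ≤ (s - r)⁻¹ * ((z (k + N)).2.1 * (‖d‖ + 1)) := by gcongr
        _ = _ := by ring
    obtain ⟨w, -, φ, hφ, hw⟩ := tendsto_subseq_of_bounded isBounded_closedBall hbd
    have hφN : Tendsto (fun k => φ k + N) atTop atTop :=
      (tendsto_add_atTop_nat N).comp hφ.tendsto_atTop
    refine ⟨fun k => φ k + N, w, ?_, hw⟩
    have gd := fun k => hN (φ k + N) (Nat.le_add_left _ _)
    have hx : Tendsto (fun k => σ (z (φ k + N)).1) atTop (𝓝 xb) :=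
      hcont.comp (hz1.comp hφN)
    have hv : Tendsto (fun k => (z (φ k + N)).1 + A (σ (z (φ k + N)).1)) atTop (𝓝 vb) := by
      have := (hz1.comp hφN).add ((A.continuous.tendsto xb).comp hx)
      simpa [hub] using this
    have ht0 : Tendsto (fun k => (z (φ k + N)).2.1) atTop (𝓝 0) :=
      (hz2.mono_right nhdsWithin_le_nhds).comp hφN
    refine H.isQuotLimit hε (fun k => (gd k).2.2.1) ht0 hx (hz3.comp hφN) hw
      (fun k => (gd k).1) (fun k => ?_)
      (hepi _ _ _ (fun k => (gd k).2.2.1) ht0 hx hv (fun k => (gd k).1.2.2.1)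
        (H.tendsto_apply hb hx hv fun k => (gd k).1))
    have h2 := (gd k).2.1
    have e1 : (z (φ k + N)).2.1 • diffQuot σ (z (φ k + N))
        = σ ((z (φ k + N)).1 + (z (φ k + N)).2.1 • (z (φ k + N)).2.2) - σ (z (φ k + N)).1 := by
      rw [diffQuot, smul_inv_smul₀ (gd k).2.2.1.ne']
    have e2 := congrArg A e1
    change _ + A (σ _) ∈ gAttentiveLoc g xb vb ε (σ _) at h2
    simp only [Function.comp_apply, smul_add]
    rw [map_smul, map_sub] at e2
    rw [e1, e2, add_sub_cancel]
    convert h2 using 1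
    abel
  have hex : ∀ d, ∃ w, IsQuotLimit h A r d w := by
    intro d
    obtain ⟨z, hz⟩ := exists_seq_tendsto (𝓝 ub ×ˢ 𝓝[>] (0 : ℝ) ×ˢ 𝓝 d)
    obtain ⟨-, w, hw, -⟩ := cluster d z hz
    exact ⟨w, hw⟩
  choose W hW using hex
  refine exists_hasStrictFDerivAt_of_tendsto_diffQuot hσ hlip (W := W) fun d => ?_
  refine tendsto_of_subseq_tendsto fun z hz => ?_
  obtain ⟨φ, w, hw, hl⟩ := cluster d z hz
  exact ⟨φ, (hw.unique hrs hs (hW d)) ▸ hl⟩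

lemma coe_sub_le_sub_coe_iff {a b c : ℝ} {y : EReal} :
    (a : EReal) - (b : EReal) ≤ y - (c : EReal) ↔ ((a + (c - b) : ℝ) : EReal) ≤ y := by
  induction y using EReal.rec with
  | bot => simp [← EReal.coe_sub]
  | top => simp
  | coe y =>
    norm_cast
    constructor <;> intro h <;> linarith

lemma lowerSemicontinuousOn_sub_coe {α : Type*} [TopologicalSpace α] {K : Set α} {g : α → EReal}
    (hg : LowerSemicontinuousOn g K) {c : α → ℝ} (hc : ContinuousOn c K) :
    LowerSemicontinuousOn (fun x => g x - (c x : EReal)) K := by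
  have hc' : ContinuousOn (fun x => ((-c x : ℝ) : EReal)) K :=
    continuous_coe_real_ereal.comp_continuousOn hc.neg
  have := hg.add' hc'.lowerSemicontinuousOn fun x _ => EReal.continuousAt_add (by simp) (by simp)
  simpa [sub_eq_add_neg] using this

lemma exists_forall_sub_coe_le {α : Type*} [TopologicalSpace α] {K : Set α} (hK : IsCompact K)
    (hne : K.Nonempty) {g : α → EReal} (hg : LowerSemicontinuousOn g K) {c : α → ℝ}
    (hc : ContinuousOn c K) :
    ∃ x ∈ K, ∀ x' ∈ K, g x - (c x : EReal) ≤ g x' - (c x' : EReal) :=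
  (lowerSemicontinuousOn_sub_coe hg hc).exists_isMinOn hne hK

/-- Fermat's rule at a local minimizer of `g - c`, with `c` differentiable. -/
lemma isFSubgrad_of_eventually_sub_le {g : E → EReal} {c : E → ℝ} {x v : E}
    (hc : HasFDerivAt c (innerSL ℝ v) x) (htop : g x ≠ ⊤) (hbot : g x ≠ ⊥)
    (hmin : ∀ᶠ x' in 𝓝 x, g x - (c x : EReal) ≤ g x' - (c x' : EReal)) : IsFSubgrad g x v := by
  refine ⟨htop, hbot, fun ε hε => ?_⟩
  obtain ⟨δ, hδ, h⟩ := Metric.eventually_nhds_iff.1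
    (hmin.and (Asymptotics.isLittleO_iff.1 hc.isLittleO hε))
  refine ⟨δ, hδ, fun x' hx' => ?_⟩
  obtain ⟨h1, h2⟩ := h (by rwa [dist_eq_norm])
  rw [← EReal.coe_toReal htop hbot] at h1 ⊢
  rw [coe_sub_le_sub_coe_iff] at h1
  refine le_trans ?_ h1
  norm_cast
  rw [Real.norm_eq_abs, innerSL_apply_apply] at h2
  linarith [neg_abs_le (c x' - c x - ⟪v, x' - x⟫)]

lemma IsFSubgrad.isLSubgrad {g : E → EReal} {x v : E} (h : IsFSubgrad g x v) :
    IsLSubgrad g x v :=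
  ⟨h.1, h.2.1, fun _ => x, fun _ => v, tendsto_const_nhds, tendsto_const_nhds,
    tendsto_const_nhds, fun _ => h⟩

lemma hasFDerivAt_quadratic {A : E →L[ℝ] E} (hA : ∀ u w, ⟪A u, w⟫ = ⟪u, A w⟫) (u x : E) :
    HasFDerivAt (fun x => 1 / 2 * ⟪A x, x⟫ + ⟪u, x⟫) (innerSL ℝ (u + A x)) x := by
  have h1 := ((A.hasFDerivAt (x := x)).inner ℝ (hasFDerivAt_id x)).const_mul (1 / 2 : ℝ)
  have h2 := (innerSL ℝ u).hasFDerivAt (x := x)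
  refine (h1.add h2).congr_fderiv ?_
  ext w
  simp only [id, add_apply, smul_apply,
    innerSL_apply_apply, inner_add_left, smul_eq_mul, ContinuousLinearMap.comp_apply,
    ContinuousLinearMap.prod_apply, fderivInnerCLM_apply, ContinuousLinearMap.id_apply]
  rw [hA w x, real_inner_comm w (A x)]
  ring

/-- `T_ε - A` is locally onto near `vb - A xb`. -/
lemma ProxIneq.eventually_exists_mem [FiniteDimensional ℝ E] {g : E → EReal} {xb vb : E}
    {r ε s ρ : ℝ} (H : ProxIneq g xb vb r ε) (hε : 0 < ε) {A : E →L[ℝ] E} (hr : 0 ≤ r)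
    (hrs : r < s) (hs : ∀ u, ⟪A u, u⟫ ≤ -(s * ‖u‖ ^ 2)) (hA : ∀ u w, ⟪A u, w⟫ = ⟪u, A w⟫)
    (hb : vb ∈ gAttentiveLoc g xb vb ε xb) (hρ : 0 < ρ)
    (hlsc : LowerSemicontinuousOn g (closedBall xb ρ)) (hbot : ∀ x, g x ≠ ⊥) :
    ∀ᶠ u in 𝓝 (vb - A xb), ∃ x, u + A x ∈ gAttentiveLoc g xb vb ε x := by
  have hsr : 0 < s - r := sub_pos.2 hrs
  set ub := vb - A xb with hub
  set δ := min ρ (ε / 2) with hδ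
  have hδ0 : 0 < δ := lt_min hρ (half_pos hε)
  have hδε : δ < ε := (min_le_right _ _).trans_lt (half_lt_self hε)
  obtain ⟨b, hgb⟩ := hb.2.2.1.exists_coe
  have t0 : Tendsto (fun u => u - ub) (𝓝 ub) (𝓝 0) := by
    simpa using (tendsto_id (x := 𝓝 ub)).sub_const ub
  have t1 : Tendsto (fun u => 2 * (s - r)⁻¹ * ‖u - ub‖) (𝓝 ub) (𝓝 0) := by
    simpa using t0.norm.const_mul (2 * (s - r)⁻¹)
  have t2 : Tendsto (fun u => ‖A xb + u‖ * (2 * (s - r)⁻¹ * ‖u - ub‖)) (𝓝 ub) (𝓝 0) := by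
    simpa using ((tendsto_id (x := 𝓝 ub)).const_add (A xb)).norm.mul t1
  have t3 : Tendsto (fun u => ‖u - ub‖ + ‖A‖ * (2 * (s - r)⁻¹ * ‖u - ub‖)) (𝓝 ub) (𝓝 0) := by
    simpa using t0.norm.add (t1.const_mul ‖A‖)
  filter_upwards [t1.eventually_lt_const hδ0, t2.eventually_lt_const hε,
    t3.eventually_lt_const hε] with u h1 h2 h3
  set c : E → ℝ := fun x => 1 / 2 * ⟪A x, x⟫ + ⟪u, x⟫ with hc
  have hcd : ∀ x, HasFDerivAt c (innerSL ℝ (u + A x)) x := hasFDerivAt_quadratic hA u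
  obtain ⟨x, hxK, hmin⟩ := exists_forall_sub_coe_le (isCompact_closedBall xb δ)
    ⟨xb, mem_closedBall_self hδ0.le⟩
    (hlsc.mono (closedBall_subset_closedBall (min_le_left _ _)))
    (c := c) (fun x _ => (hcd x).continuousAt.continuousWithinAt)
  have hxδ : ‖x - xb‖ ≤ δ := by rwa [← mem_closedBall_iff_norm]
  have hle := hmin xb (mem_closedBall_self hδ0.le)
  have htop : g x ≠ ⊤ := by
    intro hx
    rw [hx, hgb, EReal.top_sub_coe, ← EReal.coe_sub] at hle
    exact absurd (top_le_iff.1 hle) (EReal.coe_ne_top _)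
  obtain ⟨a, ha⟩ : ∃ a : ℝ, g x = a := ⟨_, (EReal.coe_toReal htop (hbot x)).symm⟩
  have hpr := H xb vb hb x (hxδ.trans_lt hδε)
  rw [ha, hgb] at hle hpr
  norm_cast at hle hpr
  have hcdiff : c x - c xb = 1 / 2 * ⟪A (x - xb), x - xb⟫ + ⟪A xb + u, x - xb⟫ := by
    have := hA x xb
    simp only [hc, map_sub, inner_sub_left, inner_sub_right, inner_add_left,
      real_inner_comm x (A xb), this]
    ring
  have hAe := hs (x - xb)
  have hvu : ⟪A xb + u, x - xb⟫ - ⟪vb, x - xb⟫ = ⟪u - ub, x - xb⟫ := by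
    rw [← inner_sub_left, hub]
    congr 1
    abel
  have hcs := real_inner_le_norm (u - ub) (x - xb)
  have hcs' := real_inner_le_norm (A xb + u) (x - xb)
  have hxb : ‖x - xb‖ ≤ 2 * (s - r)⁻¹ * ‖u - ub‖ := by
    rcases (norm_nonneg (x - xb)).eq_or_lt with h0 | h0
    · rw [← h0]; positivity
    · have : (s - r) * ‖x - xb‖ ≤ 2 * ‖u - ub‖ := by
        refine le_of_mul_le_mul_right ?_ h0
        nlinarith
      calc ‖x - xb‖ = (s - r)⁻¹ * ((s - r) * ‖x - xb‖) := by field_simp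
        _ ≤ (s - r)⁻¹ * (2 * ‖u - ub‖) := by gcongr
        _ = _ := by ring
  refine ⟨x, hxδ.trans_lt hδε, ?_, (isFSubgrad_of_eventually_sub_le (hcd x) htop (hbot x)
    (mem_of_superset (closedBall_mem_nhds_of_mem ?_) hmin)).isLSubgrad, ?_⟩
  · rw [ha, hgb]
    norm_cast
    have h4 : ‖A xb + u‖ * ‖x - xb‖ ≤ ‖A xb + u‖ * (2 * (s - r)⁻¹ * ‖u - ub‖) := by gcongr
    have h5 : 0 ≤ s * ‖x - xb‖ ^ 2 := mul_nonneg (hr.trans hrs.le) (sq_nonneg _)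
    linarith
  · rw [mem_ball_iff_norm]
    exact hxb.trans_lt h1
  · have e : u + A x - vb = (u - ub) + A (x - xb) := by rw [hub, map_sub]; abel
    rw [e]
    refine lt_of_le_of_lt (norm_add_le _ _) (lt_of_le_of_lt ?_ h3)
    gcongr
    exact (A.le_opNorm _).trans (by gcongr)

/-- Under strict twice epi-differentiability, `(T_ε - A)⁻¹` has a single-valued localization that
is strictly differentiable at `vb - A xb`. -/
lemma ProxIneq.exists_localization [FiniteDimensional ℝ E] {g : E → EReal} {xb vb : E}
    {r ε s ρ : ℝ} (H : ProxIneq g xb vb r ε) (hε : 0 < ε) {A : E →L[ℝ] E} (hr : 0 ≤ r)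
    (hrs : r < s) (hs : ∀ u, ⟪A u, u⟫ ≤ -(s * ‖u‖ ^ 2)) (hA : ∀ u w, ⟪A u, w⟫ = ⟪u, A w⟫)
    (hb : vb ∈ gAttentiveLoc g xb vb ε xb) (hρ : 0 < ρ)
    (hlsc : LowerSemicontinuousOn g (closedBall xb ρ)) (hbot : ∀ x, g x ≠ ⊥)
    (hepi : StrictTwiceEpiDiff g xb vb) :
    ∃ (σ : E → E) (D : E →L[ℝ] E),
      IsSVLocalization (fun u => {x | ∃ v ∈ gAttentiveLoc g xb vb ε x, v - A x = u})
        (vb - A xb) xb σ {u | ∃ x, u + A x ∈ gAttentiveLoc g xb vb ε x} ∧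
      HasStrictFDerivAt σ D (vb - A xb) ∧
      ∀ u x, u + A x ∈ gAttentiveLoc g xb vb ε x → σ u = x := by
  have hex := H.eventually_exists_mem hε hr hrs hs hA hb hρ hlsc hbot
  have huniq : ∀ {u x x'}, u + A x ∈ gAttentiveLoc g xb vb ε x →
      u + A x' ∈ gAttentiveLoc g xb vb ε x' → x = x' := by
    intro u x x' h h'
    have := H.norm_sub_le hs h h'
    rw [add_sub_cancel_right, add_sub_cancel_right, sub_self, norm_zero] at this
    exact sub_eq_zero.1 (norm_le_zero_iff.1 (nonpos_of_mul_nonpos_right this (sub_pos.2 hrs)))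
  let σ : E → E := fun u => Classical.epsilon fun x => u + A x ∈ gAttentiveLoc g xb vb ε x
  have hσ : ∀ u, (∃ x, u + A x ∈ gAttentiveLoc g xb vb ε x) →
      u + A (σ u) ∈ gAttentiveLoc g xb vb ε (σ u) := fun u h => Classical.epsilon_spec h
  have hσ' : ∀ u x, u + A x ∈ gAttentiveLoc g xb vb ε x → σ u = x := fun u x h =>
    huniq (hσ u ⟨x, h⟩) h
  have hσb : σ (vb - A xb) = xb := hσ' _ _ (by rwa [sub_add_cancel])
  obtain ⟨D, hD⟩ := H.exists_hasStrictFDerivAt hε hrs hs hepi hb hσb (hex.mono hσ)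
  refine ⟨σ, D, ⟨hex, hσb, univ, univ_mem, fun u hu => ?_⟩, hD, hσ'⟩
  ext x
  simp only [inter_univ, mem_singleton_iff]
  constructor
  · rintro ⟨v, hv, rfl⟩
    exact (hσ' _ _ (by rwa [sub_add_cancel])).symm
  · rintro rfl
    exact ⟨_, hσ u hu, add_sub_cancel_right _ _⟩

end LocalizedSubdifferential

/-- For a `C²` coupling, `∇ₓΦ` is strictly differentiable, and its derivative in `x` is
symmetric. -/
lemma exists_hasStrictFDerivAt_gradx {E F : Type*} [NormedAddCommGroup E]
    [InnerProductSpace ℝ E] [CompleteSpace E] [NormedAddCommGroup F] [NormedSpace ℝ F]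
    {Φ : E → F → ℝ} {xb : E} {yb : F}
    (hΦ : ContDiffAt ℝ 2 (fun p : E × F => Φ p.1 p.2) (xb, yb)) :
    ∃ L : E × F →L[ℝ] E, HasStrictFDerivAt (fun p : E × F => gradx Φ p.1 p.2) L (xb, yb) ∧
      ∀ u w : E, ⟪L (u, 0), w⟫ = ⟪u, L (w, 0)⟫ := by
  set Ψ : E × F → ℝ := fun p => Φ p.1 p.2 with hΨ
  obtain ⟨J, hJ'⟩ : ∃ J : (E →L[ℝ] ℝ) →L[ℝ] E,
      ∀ l, J l = (InnerProductSpace.toDual ℝ E).symm l :=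
    ⟨{ toFun := (InnerProductSpace.toDual ℝ E).symm
       map_add' := map_add _
       map_smul' := fun c x => by simp
       cont := (InnerProductSpace.toDual ℝ E).symm.continuous }, fun _ => rfl⟩
  have hJ : ∀ l w, ⟪J l, w⟫ = l w := fun l w => by
    rw [hJ', InnerProductSpace.toDual_symm_apply]
  obtain ⟨R, hR⟩ : ∃ R : (E × F →L[ℝ] ℝ) →L[ℝ] (E →L[ℝ] ℝ),
      ∀ l, R l = l.comp (ContinuousLinearMap.inl ℝ E F) :=
    ⟨(ContinuousLinearMap.compL ℝ E (E × F) ℝ).flip (ContinuousLinearMap.inl ℝ E F),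
      fun _ => rfl⟩
  have hev : (fun p => J (R (fderiv ℝ Ψ p))) =ᶠ[𝓝 (xb, yb)] fun p => gradx Φ p.1 p.2 := by
    filter_upwards [hΦ.eventually (by simp)] with p hp
    have hd : HasFDerivAt Ψ (fderiv ℝ Ψ p) (p.1, p.2) :=
      (hp.differentiableAt (by simp)).hasFDerivAt
    have := HasFDerivAt.comp p.1 (f := fun e : E => (e, p.2)) hd (hasFDerivAt_prodMk_left p.1 p.2)
    rw [hJ', hR, ← this.fderiv]
    rfl
  have hd : HasStrictFDerivAt (fderiv ℝ Ψ) (fderiv ℝ (fderiv ℝ Ψ) (xb, yb)) (xb, yb) :=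
    (hΦ.fderiv_right (m := 1) (by norm_num)).hasStrictFDerivAt (by simp)
  refine ⟨J.comp (R.comp (fderiv ℝ (fderiv ℝ Ψ) (xb, yb))), ?_, fun u w => ?_⟩
  · exact (J.hasStrictFDerivAt.comp (xb, yb)
      (R.hasStrictFDerivAt.comp (xb, yb) hd)).congr_of_eventuallyEq hev
  · have hsymm : IsSymmSndFDerivAt ℝ Ψ (xb, yb) := hΦ.isSymmSndFDerivAt (by simp)
    rw [real_inner_comm]
    simp only [ContinuousLinearMap.comp_apply]
    rw [real_inner_comm, hJ, real_inner_comm, hJ, hR, hR]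
    exact hsymm.eq _ _

/-- Minimizers of `g - Φ(·, y)` exist for `y` near `yb`, and converge to the unique minimizer `xb`
at `yb` as `y → yb`. -/
lemma AssumptionG.eventually_proxSet {E F : Type*} [NormedAddCommGroup E] [ProperSpace E]
    [NormedAddCommGroup F] {X : Set E} {Y : Set F} {Φ : E → F → ℝ}
    {g : E → EReal} (hG : AssumptionG X Y Φ g) (hX : IsClosed X) (hY : IsOpen Y)
    (hΦc : ContinuousOn (fun p : E × F => Φ p.1 p.2) (X ×ˢ Y)) {xb : E} {yb : F} (hyb : yb ∈ Y)
    (hprox : proxSet X Φ g yb = {xb}) (htop : g xb ≠ ⊤) {P : E × F → Prop}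
    (hP : ∀ᶠ z in 𝓝 (xb, yb), P z) :
    ∀ᶠ y in 𝓝 yb, (proxSet X Φ g y).Nonempty ∧ ∀ x ∈ proxSet X Φ g y, P (x, y) := by
  have hxb : xb ∈ proxSet X Φ g yb := hprox ▸ mem_singleton xb
  obtain ⟨hxX, hxmin⟩ := hxb
  obtain ⟨b, hgb⟩ : ∃ b : ℝ, g xb = b := ⟨_, (EReal.coe_toReal htop (hG.ne_bot xb)).symm⟩
  have hΦx : ContinuousAt (fun y => Φ xb y) yb :=
    (hΦc.comp (f := fun y => (xb, y)) (by fun_prop) fun y hy => mk_mem_prod hxX hy).continuousAt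
      (hY.mem_nhds hyb)
  have hval : Tendsto (fun y => b - Φ xb y) (𝓝 yb) (𝓝 (b - Φ xb yb)) := hΦx.const_sub b
  obtain ⟨V, hV, S, hS, hVS⟩ := hG.levelBounded yb hyb (b - Φ xb yb + 1)
  obtain ⟨K, hK, hSK⟩ : ∃ K, IsCompact K ∧ S ⊆ K :=
    ⟨closure S, hS.isCompact_closure, subset_closure⟩
  have hKX : IsCompact (K ∩ X) := hK.inter_right hX
  have hlevel : ∀ᶠ y in 𝓝 yb, ∀ x ∈ X,
      g x - (Φ x y : EReal) ≤ g xb - (Φ xb y : EReal) → x ∈ K ∩ X := by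
    filter_upwards [hV, hY.mem_nhds hyb, hval.eventually_lt_const (lt_add_one _)]
      with y hyV hyY hlt x hx hle
    refine ⟨hSK (hVS y ⟨hyV, hyY⟩ ⟨hx, hle.trans ?_⟩), hx⟩
    rw [hgb]
    exact_mod_cast hlt.le
  obtain ⟨N, hN, N', hN', hNP⟩ := mem_prod_iff.1 (nhds_prod_eq (x := xb) (y := yb) ▸ hP)
  have hfar : ∀ᶠ y in 𝓝 yb, ∀ x ∈ (K ∩ X) \ interior N,
      x ∈ X → y ∈ Y → g xb - (Φ xb y : EReal) < g x - (Φ x y : EReal) := by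
    refine (hKX.diff isOpen_interior).eventually_forall_of_forall_eventually fun x hx => ?_
    have hne : x ≠ xb := fun h => hx.2 (h ▸ mem_interior_iff_mem_nhds.2 hN)
    have hlt : g xb - (Φ xb yb : EReal) < g x - (Φ x yb : EReal) := by
      by_contra! hle
      have : x ∈ proxSet X Φ g yb := ⟨hx.1.2, fun x' hx' => hle.trans (hxmin x' hx')⟩
      rw [hprox] at this
      exact hne this
    obtain ⟨c, hc1, hc2⟩ := EReal.lt_iff_exists_real_btwn.1 hlt
    have hlsc : LowerSemicontinuousOn (fun z : E × F => g z.1 - (Φ z.1 z.2 : EReal)) (X ×ˢ Y) :=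
      lowerSemicontinuousOn_sub_coe
        (hG.lsc.comp (g := Prod.fst) continuous_fst.continuousOn fun z hz => hz.1) hΦc
    have h1 := eventually_nhdsWithin_iff.1 (hlsc (x, yb) ⟨hx.1.2, hyb⟩ c hc2)
    have h2 := (continuous_swap.tendsto (yb, x)).eventually h1
    rw [hgb] at hc1 ⊢
    have h3 : ∀ᶠ z : F × E in 𝓝 (yb, x), b - Φ xb z.1 < c :=
      (hval.comp (continuous_fst.tendsto (yb, x))).eventually_lt_const (by exact_mod_cast hc1)
    filter_upwards [h2, h3] with z h2 h3 hzX hzY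
    refine lt_trans ?_ (h2 ⟨hzX, hzY⟩)
    exact_mod_cast h3
  filter_upwards [hlevel, hfar, hN', hY.mem_nhds hyb] with y hl hf hyN' hyY
  constructor
  · have hsec : ContinuousOn (fun x => Φ x y) (K ∩ X) :=
      hΦc.comp (f := fun x => (x, y)) (by fun_prop) fun x hx => mk_mem_prod hx.2 hyY
    obtain ⟨x, hx, hmin⟩ := exists_forall_sub_coe_le hKX ⟨xb, hl xb hxX le_rfl⟩
      (hG.lsc.mono inter_subset_right) hsec
    refine ⟨x, hx.2, fun x' hx' => ?_⟩
    by_cases h : g x' - (Φ x' y : EReal) ≤ g xb - (Φ xb y : EReal)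
    · exact hmin x' (hl x' hx' h)
    · exact (hmin xb (hl xb hxX le_rfl)).trans (not_le.1 h).le
  · intro x hx
    have hle := hx.2 xb hxX
    refine hNP ⟨?_, hyN'⟩
    by_contra hxN
    exact (hf x ⟨hl x hx.1 hle, fun h => hxN (interior_subset h)⟩ hx.1 hyY).not_ge hle

/-- Strict differentiability of the solution map `p` of a fixed-point equation
`p y = G (p y, y)` whose right-hand side has vanishing strict partial derivative in `x`. -/
lemma exists_hasStrictFDerivAt_of_fixedPoint {E F : Type*} [NormedAddCommGroup E]
    [NormedSpace ℝ E] [NormedAddCommGroup F] [NormedSpace ℝ F] {S : F → Set E} {G : E × F → E}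
    {C : F →L[ℝ] E} {xb : E} {yb : F}
    (hG : HasStrictFDerivAt G (C.comp (ContinuousLinearMap.snd ℝ E F)) (xb, yb))
    (hSb : S yb = {xb})
    (hS : ∀ P : E × F → Prop, (∀ᶠ z in 𝓝 (xb, yb), P z) →
      ∀ᶠ y in 𝓝 yb, (S y).Nonempty ∧ ∀ x ∈ S y, P (x, y))
    (hfix : ∀ᶠ y in 𝓝 yb, ∀ x ∈ S y, x = G (x, y)) :
    ∃ (p : F → E) (U : Set F), U ∈ 𝓝 yb ∧ (∀ y ∈ U, S y = {p y}) ∧ p yb = xb ∧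
      HasStrictFDerivAt p C yb := by
  have hsmall : ∀ c > (0 : ℝ), ∃ U ∈ 𝓝 yb, ∀ y ∈ U, ∀ y' ∈ U, ∀ x ∈ S y, ∀ x' ∈ S y',
      ‖x - x' - C (y - y')‖ ≤ c * (‖x - x'‖ + ‖y - y'‖) := by
    intro c hc
    have h1 := Asymptotics.isLittleO_iff.1 hG.isLittleO hc
    rw [nhds_prod_eq] at h1
    obtain ⟨T, hT, hTc⟩ := mem_prod_self_iff.1 h1
    refine ⟨_, (hS (· ∈ T) hT).and hfix, fun y hy y' hy' x hx x' hx' => ?_⟩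
    have h2 : ‖G (x, y) - G (x', y') - C (y - y')‖ ≤ c * ‖(x, y) - (x', y')‖ :=
      hTc (mk_mem_prod (hy.1.2 x hx) (hy'.1.2 x' hx'))
    rw [← hy.2 x hx, ← hy'.2 x' hx'] at h2
    refine h2.trans ?_
    gcongr
    exact (norm_prod_le_iff.2 ⟨by simp, by simp⟩)
  obtain ⟨U, hU, hUc⟩ := hsmall (1 / 2) (by norm_num)
  have hne : ∀ᶠ y in 𝓝 yb, (S y).Nonempty :=
    (hS (fun _ => True) (by simp)).mono fun _ h => h.1
  let p : F → E := fun y => Classical.epsilon fun x => x ∈ S y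
  have hp : ∀ y, (S y).Nonempty → p y ∈ S y := fun y h => Classical.epsilon_spec h
  refine ⟨p, U ∩ {y | (S y).Nonempty}, inter_mem hU hne, fun y hy => ?_, ?_, ?_⟩
  · refine eq_singleton_iff_unique_mem.2 ⟨hp y hy.2, fun x hx => ?_⟩
    have := hUc y hy.1 y hy.1 x hx (p y) (hp y hy.2)
    simp only [sub_self, map_zero, sub_zero, norm_zero, add_zero] at this
    exact sub_eq_zero.1 (norm_le_zero_iff.1 (by linarith))
  · have := hp yb (hSb ▸ singleton_nonempty xb)
    rwa [hSb] at this
  · refine .of_isLittleO (Asymptotics.isLittleO_iff.2 fun c hc => ?_)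
    set c' := min (1 / 2) (c / (2 * ‖C‖ + 2)) with hc'
    have hC : 0 < 2 * ‖C‖ + 2 := by positivity
    have hc0 : 0 < c' := lt_min (by norm_num) (by positivity)
    obtain ⟨V, hV, hVc⟩ := hsmall c' hc0
    have hVn := inter_mem hV hne
    filter_upwards [prod_mem_nhds hVn hVn] with z hz
    have h := hVc _ hz.1.1 _ hz.2.1 _ (hp _ hz.1.2) _ (hp _ hz.2.2)
    set e := p z.1 - p z.2
    have h1 : ‖e‖ ≤ ‖e - C (z.1 - z.2)‖ + ‖C‖ * ‖z.1 - z.2‖ := by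
      have h2 := norm_add_le (e - C (z.1 - z.2)) (C (z.1 - z.2))
      rw [sub_add_cancel] at h2
      exact h2.trans (by gcongr; exact C.le_opNorm _)
    have h2 : c' ≤ 1 / 2 := min_le_left _ _
    have h3 : c' * (2 * ‖C‖ + 2) ≤ c := (le_div_iff₀ hC).1 (min_le_right _ _)
    have h4 : ‖e‖ ≤ (2 * ‖C‖ + 1) * ‖z.1 - z.2‖ := by
      nlinarith [norm_nonneg e, norm_nonneg (z.1 - z.2)]
    calc ‖e - C (z.1 - z.2)‖ ≤ c' * (‖e‖ + ‖z.1 - z.2‖) := h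
      _ ≤ c' * ((2 * ‖C‖ + 1) * ‖z.1 - z.2‖ + ‖z.1 - z.2‖) := by gcongr
      _ = c' * (2 * ‖C‖ + 2) * ‖z.1 - z.2‖ := by ring
      _ ≤ c * ‖z.1 - z.2‖ := by gcongr

/-- A bound `⟪M u, u⟫ ≤ c ‖u‖²` with `c < r⁻¹` on `M = -A⁻¹` makes `-A` uniformly elliptic with a
modulus larger than `r`. -/
lemma exists_lt_inner_le_of_inv_le {E : Type*} [NormedAddCommGroup E] [InnerProductSpace ℝ E]
    {A M : E →L[ℝ] E} (hA : ∀ u w, ⟪A u, w⟫ = ⟪u, A w⟫) (hneg : ∀ u, u ≠ 0 → ⟪A u, u⟫ < 0)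
    (hAM : A.comp M = -ContinuousLinearMap.id ℝ E) {r c : ℝ} (hr : 0 < r) (hc : c < r⁻¹)
    (hM : ∀ u, ⟪M u, u⟫ ≤ c * ‖u‖ ^ 2) :
    ∃ s, r < s ∧ ∀ u, ⟪A u, u⟫ ≤ -(s * ‖u‖ ^ 2) := by
  have hr' : 0 < r⁻¹ := inv_pos.2 hr
  set c' := max c (r⁻¹ / 2) with hc'
  have hc0 : 0 < c' := lt_max_of_lt_right (half_pos hr')
  have hc1 : c' < r⁻¹ := max_lt hc (half_lt_self hr')
  refine ⟨c'⁻¹, (lt_inv_comm₀ hc0 hr).1 hc1, fun u => ?_⟩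
  have hAMu : A (M u) = -u := by simpa using congrArg (fun T : E →L[ℝ] E => T u) hAM
  have hz : ⟪A (u - c'⁻¹ • M u), u - c'⁻¹ • M u⟫ ≤ 0 := by
    rcases eq_or_ne (u - c'⁻¹ • M u) 0 with h | h
    · simp [h]
    · exact (hneg _ h).le
  have h1 : ⟪A u, M u⟫ = -‖u‖ ^ 2 := by
    rw [hA, hAMu, inner_neg_right, real_inner_self_eq_norm_sq]
  have h2 : ⟪M u, u⟫ ≤ c' * ‖u‖ ^ 2 :=
    (hM u).trans (by gcongr; exact le_max_left _ _)
  have h3 : c'⁻¹ ^ 2 * ⟪M u, u⟫ ≤ c'⁻¹ * ‖u‖ ^ 2 := by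
    calc _ ≤ c'⁻¹ ^ 2 * (c' * ‖u‖ ^ 2) := by gcongr
      _ = _ := by field_simp
  simp only [map_sub, map_smul, hAMu, inner_sub_left, inner_sub_right, real_inner_smul_left,
    real_inner_smul_right, inner_neg_left, h1, real_inner_self_eq_norm_sq] at hz
  rw [real_inner_comm] at h3
  linarith

/-- If `x` minimizes `g - Φ(·, y)` and `(x, y)` is close to `(xb, yb)`, then `∇ₓΦ(x, y)` belongs to
the `g`-attentive localization of `∂g` at `x`. -/
lemma eventually_gradx_mem_gAttentiveLoc {E F : Type*} [NormedAddCommGroup E]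
    [InnerProductSpace ℝ E] [CompleteSpace E] [NormedAddCommGroup F] [NormedSpace ℝ F] {X : Set E} {Y : Set F} {Φ : E → F → ℝ} {g : E → EReal}
    (hY : IsOpen Y) (hΦ : ContDiffOn ℝ 2 (fun p : E × F => Φ p.1 p.2) (interior X ×ˢ Y))
    (hG : AssumptionG X Y Φ g) {xb vb : E} {yb : F} (hxb : xb ∈ interior X) (hyb : yb ∈ Y)
    (hvb : vb = gradx Φ xb yb) (htop : g xb ≠ ⊤) {ε : ℝ} (hε : 0 < ε) :
    ∀ᶠ z : E × F in 𝓝 (xb, yb), z.1 ∈ proxSet X Φ g z.2 →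
      gradx Φ z.1 z.2 ∈ gAttentiveLoc g xb vb ε z.1 := by
  have hO : IsOpen (interior X ×ˢ Y) := isOpen_interior.prod hY
  have hΦb := hΦ.contDiffAt (hO.mem_nhds (mk_mem_prod hxb hyb))
  obtain ⟨L, hL, -⟩ := exists_hasStrictFDerivAt_gradx hΦb
  obtain ⟨b, hgb⟩ : ∃ b : ℝ, g xb = b := ⟨_, (EReal.coe_toReal htop (hG.ne_bot xb)).symm⟩
  have hval : ContinuousAt (fun z : E × F => b + (Φ z.1 z.2 - Φ xb z.2)) (xb, yb) := by
    refine continuousAt_const.add (hΦb.continuousAt.sub ?_)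
    exact ContinuousAt.comp (f := fun z : E × F => (xb, z.2)) (x := (xb, yb))
      hΦb.continuousAt (by fun_prop)
  have hlt : ∀ᶠ z : E × F in 𝓝 (xb, yb), b + (Φ z.1 z.2 - Φ xb z.2) < b + ε :=
    hval.eventually_lt_const (by simpa using hε)
  have hgrad : ∀ᶠ z : E × F in 𝓝 (xb, yb), ‖gradx Φ z.1 z.2 - vb‖ < ε :=
    (hL.continuousAt.sub continuousAt_const).norm.eventually_lt_const (by simpa [hvb] using hε)
  have hx : ∀ᶠ z : E × F in 𝓝 (xb, yb), ‖z.1 - xb‖ < ε :=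
    (continuous_fst.continuousAt.sub continuousAt_const).norm.eventually_lt_const
      (by simpa using hε)
  filter_upwards [hO.mem_nhds (mk_mem_prod hxb hyb), hlt, hgrad, hx]
  rintro ⟨x, y⟩ hz hlt hgrad hx ⟨hxX, hmin⟩
  have hle : g x ≤ ((b + (Φ x y - Φ xb y) : ℝ) : EReal) := by
    have h := hmin xb (interior_subset hxb)
    rw [hgb] at h
    by_contra! hlt'
    refine h.not_gt ?_
    rw [← EReal.coe_sub, EReal.lt_sub_iff_add_lt (by simp) (by simp), ← EReal.coe_add]
    convert hlt' using 2
    ring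
  refine ⟨hx, ?_, IsFSubgrad.isLSubgrad (isFSubgrad_of_eventually_sub_le (c := fun x => Φ x y)
    ?_ (hle.trans_lt (EReal.coe_lt_top _)).ne (hG.ne_bot x) ?_), hgrad⟩
  · rw [hgb]
    exact hle.trans_lt (by exact_mod_cast hlt)
  · have hd := ((hΦ.contDiffAt (hO.mem_nhds hz)).differentiableAt (by simp)).hasFDerivAt
    have := (HasFDerivAt.comp x (f := fun e : E => (e, y)) hd
      (hasFDerivAt_prodMk_left x y)).differentiableAt.hasGradientAt
    exact this.hasFDerivAt
  · filter_upwards [mem_interior_iff_mem_nhds.1 hz.1] with x' hx'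
    exact hmin x' hx'
theorem prox_strictly_differentiable {n m : ℕ}
    (X : Set (EuclideanSpace ℝ (Fin n))) (Y : Set (EuclideanSpace ℝ (Fin m)))
    (Φ : EuclideanSpace ℝ (Fin n) → EuclideanSpace ℝ (Fin m) → ℝ)
    (hXcl : IsClosed X) (hXint : (interior X).Nonempty)
    (hYne : Y.Nonempty) (hYop : IsOpen Y)
    (hΦc : ContinuousOn (fun p : (EuclideanSpace ℝ (Fin n)) × (EuclideanSpace ℝ (Fin m)) => Φ p.1 p.2) (X ×ˢ Y))
    (hΦd2 : ContDiffOn ℝ 2 (fun p : (EuclideanSpace ℝ (Fin n)) × (EuclideanSpace ℝ (Fin m)) => Φ p.1 p.2) ((interior X) ×ˢ Y))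
    (g : EuclideanSpace ℝ (Fin n) → EReal) (hG : AssumptionG X Y Φ g)
    (xb vb : EuclideanSpace ℝ (Fin n)) (hxb : xb ∈ interior X)
    (r : ℝ) (hr : 0 < r) (hpr : ProxRegularAt g xb vb r)
    (yb : EuclideanSpace ℝ (Fin m)) (hyb : yb ∈ Y) (hprox : proxSet X Φ g yb = {xb})
    (hvb : vb = gradx Φ xb yb)
    (A : (EuclideanSpace ℝ (Fin n)) →L[ℝ] (EuclideanSpace ℝ (Fin n))) (hA : A = fderiv ℝ (fun x => gradx Φ x yb) xb)
    (hneg : ∀ u : EuclideanSpace ℝ (Fin n), u ≠ 0 → ⟪A u, u⟫ < 0)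
    (M : (EuclideanSpace ℝ (Fin n)) →L[ℝ] (EuclideanSpace ℝ (Fin n)))
    (hMA : M.comp A = -ContinuousLinearMap.id ℝ (EuclideanSpace ℝ (Fin n)))
    (hAM : A.comp M = -ContinuousLinearMap.id ℝ (EuclideanSpace ℝ (Fin n)))
    (lmax : ℝ) (hlmax : ∀ u : EuclideanSpace ℝ (Fin n), ⟪M u, u⟫ ≤ lmax * ‖u‖ ^ 2) (hlr : lmax < r⁻¹)
    (B : (EuclideanSpace ℝ (Fin m)) →L[ℝ] (EuclideanSpace ℝ (Fin n))) (hB : B = fderiv ℝ (fun y => gradx Φ xb y) yb)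
    (hepi : StrictTwiceEpiDiff g xb vb) :
    ∃ ε > (0 : ℝ), ∃ (σ : EuclideanSpace ℝ (Fin n) → EuclideanSpace ℝ (Fin n)) (Uσ : Set (EuclideanSpace ℝ (Fin n))) (D : (EuclideanSpace ℝ (Fin n)) →L[ℝ] (EuclideanSpace ℝ (Fin n)))
      (p : EuclideanSpace ℝ (Fin m) → EuclideanSpace ℝ (Fin n)) (U : Set (EuclideanSpace ℝ (Fin m))),
      IsSVLocalization (fun u => {x | ∃ v ∈ gAttentiveLoc g xb vb ε x, v - A x = u})
        (vb - A xb) xb σ Uσ ∧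
      HasStrictFDerivAt σ D (vb - A xb) ∧
      U ∈ 𝓝 yb ∧ (∀ y ∈ U, proxSet X Φ g y = {p y}) ∧ p yb = xb ∧
      HasStrictFDerivAt p (D.comp B) yb := by
  obtain ⟨L, hL, hLsymm⟩ := exists_hasStrictFDerivAt_gradx
    (hΦd2.contDiffAt ((isOpen_interior.prod hYop).mem_nhds (mk_mem_prod hxb hyb)))
  have hAL : ∀ u, A u = L (u, 0) := fun u => by
    have h := hL.hasFDerivAt.comp xb (f := fun x => (x, yb)) (hasFDerivAt_prodMk_left xb yb)
    exact congrArg (fun T => T u) (hA.trans h.fderiv)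
  have hBL : ∀ w, B w = L (0, w) := fun w => by
    have h := hL.hasFDerivAt.comp yb (hasFDerivAt_prodMk_right xb yb)
    exact congrArg (fun T => T w) (hB.trans h.fderiv)
  have hAsymm : ∀ u w, ⟪A u, w⟫ = ⟪u, A w⟫ := fun u w => by
    rw [hAL, hAL]
    exact hLsymm u w
  obtain ⟨s, hrs, hs⟩ := exists_lt_inner_le_of_inv_le hAsymm hneg hAM hr hlr hlmax
  obtain ⟨ε, hε, H⟩ := hpr.exists_proxIneq
  obtain ⟨ρ, hρ, hρX⟩ := Metric.nhds_basis_closedBall.mem_iff.1 (isOpen_interior.mem_nhds hxb)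
  obtain ⟨σ, D, hσ, hσD, hσeq⟩ := H.exists_localization hε hr.le hrs hs hAsymm
    (mem_gAttentiveLoc_self hε hpr.2.2.2.1) hρ
    (hG.lsc.mono (hρX.trans interior_subset)) hG.ne_bot hepi
  have hev {P : EuclideanSpace ℝ (Fin n) × EuclideanSpace ℝ (Fin m) → Prop}
      (hP : ∀ᶠ z in 𝓝 (xb, yb), P z) :=
    hG.eventually_proxSet hXcl hYop hΦc hyb hprox hpr.1 hP
  have hk : HasStrictFDerivAt
      (fun z : EuclideanSpace ℝ (Fin n) × EuclideanSpace ℝ (Fin m) => gradx Φ z.1 z.2 - A z.1)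
      (B.comp (ContinuousLinearMap.snd ℝ _ _)) (xb, yb) := by
    refine (hL.sub (A.hasStrictFDerivAt.comp (xb, yb) hasStrictFDerivAt_fst)).congr_fderiv ?_
    refine ContinuousLinearMap.ext fun z => ?_
    have h : z - (z.1, 0) = (0, z.2) := by ext <;> simp
    simp [hAL, hBL, ← map_sub, h]
  have hσk := HasStrictFDerivAt.comp (xb, yb) (g := σ) (hvb ▸ hσD) hk
  have hfix : ∀ᶠ y in 𝓝 yb, ∀ x ∈ proxSet X Φ g y, x = σ (gradx Φ x y - A x) := by
    filter_upwards [hev (eventually_gradx_mem_gAttentiveLoc hYop hΦd2 hG hxb hyb hvb hpr.1 hε)]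
      with y hy x hx
    refine (hσeq _ x ?_).symm
    rw [sub_add_cancel]
    exact hy.2 x hx hx
  obtain ⟨p, U, hU, hUp, hpb, hp⟩ := exists_hasStrictFDerivAt_of_fixedPoint
    (C := D.comp B) hσk hprox (fun P hP => hev hP) hfix
  exact ⟨ε, hε, σ, _, D, p, U, hσ, hσD, hU, hUp, hpb, hp⟩

end
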